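/- (Qudit entropic uncertainty relation in the extended MUB regime.) Let X = (X_1, …, X_d) and Y = (Y_1, …, Y_d) be rank-one projective measurements on ℂ^d with overlap matrix C⁽²⁾ (entries C⁽²⁾_{ij} = tr(X_i Y_j)), and let σ ∈ (0,1). Assume that ‖C⁽²⁾‖_{(1+σ) → ((1+σ)/σ)} ≤ d^{−(1−σ)/(1+σ)} (this is the value the norm takes if the extended-MUB-regime conjecture holds with σ = σ₂, the second largest singular value of C⁽²⁾, and μ = λ = 1/(1+σ)). Then for every density matrix ρ on ℂ^d: H(X)_ρ + H(Y)_ρ ≥ (1+σ)·S(ρ) + (1−σ)·log d. -/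

import Mathlib

open scoped BigOperators ComplexOrder

/-- The vector `p`-norm of a complex vector, for a real exponent `p`. -/
noncomputable def vecPNorm {n : Type*} [Fintype n] (p : ℝ) (v : n → ℂ) : ℝ :=
  (∑ i, ‖v i‖ ^ p) ^ (1 / p)

/-- The `(r → s)` operator norm of a complex matrix, for real exponents. -/
noncomputable def matPNorm {m n : Type*} [Fintype m] [Fintype n] (r s : ℝ)
    (C : Matrix m n ℂ) : ℝ :=
  sSup {t : ℝ | ∃ φ : n → ℂ, φ ≠ 0 ∧ t = vecPNorm s (C.mulVec φ) / vecPNorm r φ}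

/-- Shannon entropy of a finite probability vector (natural log, `0 log 0 = 0`). -/
noncomputable def shannonEntropy {ι : Type*} [Fintype ι] (p : ι → ℝ) : ℝ :=
  -∑ i, p i * Real.log (p i)

/-- Von Neumann entropy: `-∑ λᵢ log λᵢ` over the eigenvalues of a Hermitian matrix. -/
noncomputable def vonNeumannEntropy {d : ℕ} (ρ : Matrix (Fin d) (Fin d) ℂ) : ℝ :=
  if h : ρ.IsHermitian then -∑ i, h.eigenvalues i * Real.log (h.eigenvalues i) else 0

open Filter Topology

lemma qeu_real {ι κ : Type*} [Fintype ι] [Fintype κ]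
    (w l a : ι → ℝ) (q a' : κ → ℝ) (hl : ∀ i, 0 ≤ l i) (ha : ∀ i, 0 < a i)
    (hq : ∀ j, 0 ≤ q j) (ha' : ∀ j, 0 < a' j)
    (h : ∀ s : ℝ, 0 ≤ s → ∑ j, q j ^ 2 / (s * q j + a' j) ≤ ∑ i, w i * (l i ^ 2 / (s * l i + a i)))
    (h1 : ∑ i, w i * l i = 1) (h2 : ∑ j, q j = 1) :
    ∑ j, q j * (Real.log (q j) - Real.log (a' j))
      ≤ ∑ i, w i * (l i * (Real.log (l i) - Real.log (a i))) := by
  let G : ℝ → ℝ := fun s => ∑ i, w i * (l i * (Real.log (s * l i + a i) - Real.log (a i)))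
    - ∑ j, q j * (Real.log (s * q j + a' j) - Real.log (a' j))
  have hder : ∀ s : ℝ, 0 ≤ s → HasDerivAt G (∑ i, w i * (l i ^ 2 / (s * l i + a i))
      - ∑ j, q j ^ 2 / (s * q j + a' j)) s := by
    intro s hs
    have key : ∀ x y : ℝ, 0 ≤ x → 0 < y →
        HasDerivAt (fun s : ℝ => x * (Real.log (s * x + y) - Real.log y)) (x ^ 2 / (s * x + y)) s := by
      intro x y hx hy
      have hpos : 0 < s * x + y := by positivity
      have := (((((hasDerivAt_id s).mul_const x).add_const y).log hpos.ne').sub_const (Real.log y)).const_mul x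
      refine this.congr_deriv ?_
      simp; ring
    refine HasDerivAt.sub ?_ ?_
    · exact HasDerivAt.fun_sum fun i _ => (key _ _ (hl i) (ha i)).const_mul (w i)
    · exact HasDerivAt.fun_sum fun j _ => (key _ _ (hq j) (ha' j))
  have hmono : MonotoneOn G (Set.Ici 0) := by
    refine monotoneOn_of_deriv_nonneg (convex_Ici 0)
      (fun s hs => (hder s hs).continuousAt.continuousWithinAt) ?_ ?_
    · intro s hs
      rw [interior_Ici] at hs
      exact (hder s (le_of_lt hs)).differentiableAt.differentiableWithinAt
    · intro s hs
      rw [interior_Ici] at hs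
      rw [(hder s (le_of_lt hs)).deriv]
      linarith [h s (le_of_lt hs)]
  have hG : ∀ T : ℝ, 0 < T → 0 ≤ G T := by
    intro T hT
    have := hmono (Set.mem_Ici.2 le_rfl) (Set.mem_Ici.2 hT.le) hT.le
    have h0 : G 0 = 0 := by simp [G]
    linarith
  have hlog : ∀ T x y : ℝ, 0 < T → 0 ≤ x → 0 < y →
      Real.log (T * x + y) = Real.log T + Real.log (x + y / T) := by
    intro T x y hT hx hy
    rw [← Real.log_mul hT.ne' (by positivity)]
    congr 1; field_simp
  have hF : ∀ T : ℝ, 0 < T →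
      ∑ j, q j * (Real.log (q j + a' j / T) - Real.log (a' j))
      ≤ ∑ i, w i * (l i * (Real.log (l i + a i / T) - Real.log (a i))) := by
    intro T hT
    have e1 : ∑ i, w i * (l i * (Real.log (T * l i + a i) - Real.log (a i)))
        = Real.log T * ∑ i, w i * l i + ∑ i, w i * (l i * (Real.log (l i + a i / T) - Real.log (a i))) := by
      rw [Finset.mul_sum, ← Finset.sum_add_distrib]
      refine Finset.sum_congr rfl fun i _ => ?_
      rw [hlog T _ _ hT (hl i) (ha i)]; ring
    have e2 : ∑ j, q j * (Real.log (T * q j + a' j) - Real.log (a' j))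
        = Real.log T * ∑ j, q j + ∑ j, q j * (Real.log (q j + a' j / T) - Real.log (a' j)) := by
      rw [Finset.mul_sum, ← Finset.sum_add_distrib]
      refine Finset.sum_congr rfl fun i _ => ?_
      rw [hlog T _ _ hT (hq i) (ha' i)]; ring
    have := hG T hT
    simp only [G] at this
    rw [e1, e2, h1, h2] at this
    linarith
  have hlim : ∀ x y : ℝ, 0 ≤ x → Tendsto (fun T : ℝ => x * (Real.log (x + y / T) - Real.log y)) atTop
      (𝓝 (x * (Real.log x - Real.log y))) := by
    intro x y hx
    rcases hx.eq_or_lt with rfl | hx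
    · simp
    · have t : Tendsto (fun T : ℝ => x + y / T) atTop (𝓝 x) := by
        simpa using (tendsto_const_nhds (x := x)).add ((tendsto_const_nhds (x := y)).div_atTop tendsto_id)
      exact ((t.log hx.ne').sub_const _).const_mul _
  refine le_of_tendsto_of_tendsto
    (tendsto_finsetSum _ fun j _ => hlim (q j) (a' j) (hq j))
    (tendsto_finsetSum _ fun i _ => (hlim (l i) (a i) (hl i)).const_mul (w i)) ?_
  filter_upwards [eventually_gt_atTop 0] with T hT using hF T hT

lemma qeu_gibbs {κ : Type*} [Fintype κ] (q c : κ → ℝ) (hq : ∀ j, 0 ≤ q j) (hc : ∀ j, 0 < c j)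
    (h2 : ∑ j, q j = 1) :
    ∑ j, q j * (Real.log (c j) - Real.log (q j)) ≤ Real.log (∑ j, c j) := by
  have hne : Nonempty κ := by
    by_contra hne
    rw [not_nonempty_iff] at hne
    simp at h2
  have hZ : 0 < ∑ j, c j := Finset.sum_pos (fun j _ => hc j) Finset.univ_nonempty
  set Z := ∑ j, c j with hZd
  have : ∀ j, q j * (Real.log (c j) - Real.log (q j)) ≤ q j * Real.log Z + (c j / Z - q j) := by
    intro j
    rcases (hq j).eq_or_lt with h | h
    · rw [← h]; have := (hc j).le; simp; positivity
    · have h3 := Real.log_le_sub_one_of_pos (x := c j / (Z * q j)) (div_pos (hc j) (by positivity))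
      rw [Real.log_div (hc j).ne' (by positivity), Real.log_mul hZ.ne' h.ne'] at h3
      have h4 := mul_le_mul_of_nonneg_left h3 h.le
      have h5 : q j * (c j / (Z * q j) - 1) = c j / Z - q j := by field_simp
      nlinarith
  refine (Finset.sum_le_sum fun j _ => this j).trans ?_
  rw [Finset.sum_add_distrib, Finset.sum_sub_distrib, ← Finset.sum_mul, ← Finset.sum_div, h2, ← hZd,
    div_self hZ.ne']
  simp

lemma qeu_trace {d : ℕ} (E X Z : Matrix (Fin d) (Fin d) ℂ) (hE : E.IsHermitian) (hE2 : E * E = E)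
    (hX : X.IsHermitian) (hX2 : X * X = X) (hZ : Z.IsHermitian) (l c : ℝ) (hc : 0 < c) :
    2 * l * ((E * Z * X).trace).re - c * ((E * Z * X * Z).trace).re
      ≤ ((E * X).trace).re * (l ^ 2 / c) := by
  have h0 : ∀ W : Matrix (Fin d) (Fin d) ℂ, W.IsHermitian → 0 ≤ ((E * W * X * W).trace).re := by
    intro W hW
    have h := (Matrix.posSemidef_self_mul_conjTranspose (E * W * X)).trace_nonneg
    have e : ((E * W * X) * (E * W * X).conjTranspose).trace = (E * W * X * W).trace := by
      rw [Matrix.conjTranspose_mul, Matrix.conjTranspose_mul, hE.eq, hX.eq, hW.eq]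
      calc (E * W * X * (X * (W * E))).trace = (E * W * (X * X) * W * E).trace := by
            simp only [Matrix.mul_assoc]
        _ = (E * (E * W * (X * X) * W)).trace := Matrix.trace_mul_comm _ _
        _ = ((E * E) * W * (X * X) * W).trace := by simp only [Matrix.mul_assoc]
        _ = _ := by rw [hE2, hX2]
    rw [e] at h
    exact (Complex.le_def.1 h).1
  have h := h0 ((c : ℂ) • Z - (l : ℂ) • 1) (by
    refine Matrix.IsHermitian.sub ?_ ?_
    · simp [Matrix.IsHermitian, Matrix.conjTranspose_smul, hZ.eq]
    · simp [Matrix.IsHermitian, Matrix.conjTranspose_smul])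
  have hcj : ((E * X * Z).trace).re = ((E * Z * X).trace).re := by
    have : (E * X * Z).trace = star ((E * Z * X).trace) := by
      rw [← Matrix.trace_conjTranspose, Matrix.conjTranspose_mul, Matrix.conjTranspose_mul, hE.eq,
        hX.eq, hZ.eq, ← Matrix.mul_assoc]
      exact (Matrix.trace_mul_cycle X Z E).symm
    rw [this]; simp
  have ex : (E * ((c : ℂ) • Z - (l : ℂ) • 1) * X * ((c : ℂ) • Z - (l : ℂ) • 1))
     = ((c * c : ℝ) : ℂ) • (E * Z * X * Z) - ((c * l : ℝ) : ℂ) • (E * Z * X)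
       - ((c * l : ℝ) : ℂ) • (E * X * Z) + ((l * l : ℝ) : ℂ) • (E * X) := by
    simp only [Matrix.mul_sub, Matrix.sub_mul, Matrix.mul_smul, Matrix.smul_mul, Matrix.mul_one, smul_sub, smul_smul]
    push_cast
    rw [mul_comm (l : ℂ) (c : ℂ)]
    abel
  rw [ex] at h
  simp only [Matrix.trace_add, Matrix.trace_sub, Matrix.trace_smul, smul_eq_mul, Complex.add_re, Complex.sub_re,
    Complex.re_ofReal_mul, hcj] at h
  rw [← mul_le_mul_iff_right₀ hc]
  have : c * (((E * X).trace).re * (l ^ 2 / c)) = ((E * X).trace).re * l ^ 2 := by field_simp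
  rw [this]
  nlinarith

lemma qeu_bil {d : ℕ} (E X : Fin d → Matrix (Fin d) (Fin d) ℂ) (Z W : Matrix (Fin d) (Fin d) ℂ)
    (f g : Fin d → ℝ) :
    ∑ k, ∑ i, (f k * g i) * ((E k * Z * X i * W).trace).re
      = (((∑ k, (f k : ℂ) • E k) * Z * (∑ i, (g i : ℂ) • X i) * W).trace).re := by
  simp only [Finset.sum_mul, Finset.mul_sum, Matrix.trace_sum, Complex.re_sum, Matrix.smul_mul,
    Matrix.mul_smul, Matrix.trace_smul, smul_eq_mul, Complex.re_ofReal_mul]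
  rw [Finset.sum_comm]
  refine Finset.sum_congr rfl fun i _ => Finset.sum_congr rfl fun k _ => ?_
  ring

lemma qeu_step {d : ℕ} (E X Y : Fin d → Matrix (Fin d) (Fin d) ℂ)
    (hEherm : ∀ i, (E i).IsHermitian) (hEproj : ∀ i, E i * E i = E i) (hEsum : ∑ i, E i = 1)
    (hXherm : ∀ i, (X i).IsHermitian) (hXproj : ∀ i, X i * X i = X i) (hXsum : ∑ i, X i = 1)
    (hYherm : ∀ j, (Y j).IsHermitian) (hYproj : ∀ j, Y j * Y j = Y j)
    (hYorth : ∀ j k, j ≠ k → Y j * Y k = 0)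
    (l a z : Fin d → ℝ) (s : ℝ) (hs : 0 ≤ s) (hl : ∀ k, 0 ≤ l k) (ha : ∀ i, 0 < a i) :
    ∑ j, (2 * z j * (((∑ k, (l k : ℂ) • E k) * Y j).trace).re
      - z j ^ 2 * (s * (((∑ k, (l k : ℂ) • E k) * Y j).trace).re
          + ∑ i, a i * ((X i * Y j).trace).re))
    ≤ ∑ k, ∑ i, ((E k * X i).trace).re * (l k ^ 2 / (s * l k + a i)) := by
  set ρ := ∑ k, (l k : ℂ) • E k with hρ
  set Z := ∑ j, (z j : ℂ) • Y j with hZ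
  have hZh : Z.IsHermitian := by
    rw [hZ, Matrix.IsHermitian, Matrix.conjTranspose_sum]
    refine Finset.sum_congr rfl fun j _ => ?_
    simp [Matrix.conjTranspose_smul, (hYherm j).eq]
  have hZ2 : Z * Z = ∑ j, ((z j ^ 2 : ℝ) : ℂ) • Y j := by
    rw [hZ, Finset.sum_mul]
    refine Finset.sum_congr rfl fun j _ => ?_
    rw [Finset.mul_sum, Finset.sum_eq_single j]
    · rw [Matrix.smul_mul, Matrix.mul_smul, hYproj, smul_smul]; push_cast; rw [sq]
    · intro k _ hk
      rw [Matrix.smul_mul, Matrix.mul_smul, hYorth j k hk.symm]; simp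
    · simp
  have h1 : ∑ k, ∑ i, l k * ((E k * Z * X i).trace).re = ∑ j, z j * ((ρ * Y j).trace).re := by
    have := qeu_bil E X Z 1 l (fun _ => 1)
    simp only [mul_one, Complex.ofReal_one, one_smul, hXsum, ← hρ] at this
    rw [this, hZ]
    simp [Finset.mul_sum, Matrix.trace_sum]
  have h2 : ∑ k, ∑ i, l k * ((E k * Z * X i * Z).trace).re = ∑ j, z j ^ 2 * ((ρ * Y j).trace).re := by
    have := qeu_bil E X Z Z l (fun _ => 1)
    simp only [mul_one, Complex.ofReal_one, one_smul, hXsum, ← hρ] at this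
    rw [this, Matrix.mul_assoc, hZ2]
    simp only [Finset.mul_sum, Matrix.trace_sum, Matrix.mul_smul, Matrix.trace_smul, smul_eq_mul,
      Complex.re_sum, Complex.re_ofReal_mul]
  have h3 : ∑ k, ∑ i, a i * ((E k * Z * X i * Z).trace).re
      = ∑ j, z j ^ 2 * ∑ i, a i * ((X i * Y j).trace).re := by
    have := qeu_bil E X Z Z (fun _ => 1) a
    simp only [one_mul, Complex.ofReal_one, one_smul, hEsum] at this
    rw [this, Matrix.trace_mul_comm, ← Matrix.mul_assoc, hZ2, Matrix.trace_mul_comm]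
    simp only [Finset.sum_mul, Finset.mul_sum, Matrix.trace_sum, Matrix.mul_smul, Matrix.smul_mul,
      Matrix.trace_smul, smul_eq_mul, Complex.re_sum, Complex.re_ofReal_mul]
  calc _ = ∑ k, ∑ i, (2 * l k * ((E k * Z * X i).trace).re
        - (s * l k + a i) * ((E k * Z * X i * Z).trace).re) := by
        have e : ∀ k i, (2 * l k * ((E k * Z * X i).trace).re
          - (s * l k + a i) * ((E k * Z * X i * Z).trace).re)
          = 2 * (l k * ((E k * Z * X i).trace).re) - (s * (l k * ((E k * Z * X i * Z).trace).re)
            + a i * ((E k * Z * X i * Z).trace).re) := fun k i => by ring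
        simp only [← Finset.mul_sum] at h1 h2
        simp only [e, Finset.sum_sub_distrib, Finset.sum_add_distrib, ← Finset.mul_sum, h1, h2, h3]
        rw [Finset.mul_sum, Finset.mul_sum, ← Finset.sum_add_distrib, ← Finset.sum_sub_distrib,
          ← Finset.sum_sub_distrib]
        refine Finset.sum_congr rfl fun j _ => ?_
        ring
    _ ≤ _ := by
        refine Finset.sum_le_sum fun k _ => Finset.sum_le_sum fun i _ => ?_
        have := hl k
        have := ha i
        exact qeu_trace _ _ _ (hEherm k) (hEproj k) (hXherm i) (hXproj i) hZh _ _ (by positivity)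

lemma qeu_spec {d : ℕ} (ρ : Matrix (Fin d) (Fin d) ℂ) (h : ρ.IsHermitian) :
    ∃ E : Fin d → Matrix (Fin d) (Fin d) ℂ, (∀ i, (E i).IsHermitian) ∧ (∀ i, E i * E i = E i) ∧
      ∑ i, E i = 1 ∧ (∀ i, (E i).trace = 1) ∧ ρ = ∑ i, (h.eigenvalues i : ℂ) • E i := by
  have hsp := h.spectral_theorem
  rw [Unitary.conjStarAlgAut_apply] at hsp
  set U : Matrix (Fin d) (Fin d) ℂ := ↑h.eigenvectorUnitary with hU
  have hU1 : star U * U = 1 := Unitary.coe_star_mul_self h.eigenvectorUnitary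
  have hU2 : U * star U = 1 := Unitary.coe_mul_star_self h.eigenvectorUnitary
  refine ⟨fun k => U * Matrix.single k k 1 * star U, fun k => ?_, fun k => ?_, ?_, fun k => ?_, ?_⟩
  · rw [Matrix.IsHermitian, Matrix.star_eq_conjTranspose, Matrix.conjTranspose_mul,
      Matrix.conjTranspose_mul, Matrix.conjTranspose_conjTranspose, Matrix.conjTranspose_single]
    simp [Matrix.mul_assoc]
  · calc _ = U * Matrix.single k k 1 * (star U * U) * Matrix.single k k 1 * star U := by
          simp only [Matrix.mul_assoc]
      _ = _ := by rw [hU1, Matrix.mul_one, Matrix.mul_assoc U]; simp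
  · rw [← Finset.sum_mul, ← Finset.mul_sum, ← hU2]
    congr 1
    have : ∑ k : Fin d, Matrix.single k k (1 : ℂ) = 1 := by
      ext i j
      by_cases hij : i = j
      · subst hij
        simp [Matrix.sum_apply, Matrix.single_apply]
      · rw [Matrix.one_apply_ne hij, Matrix.sum_apply]
        refine Finset.sum_eq_zero fun k _ => ?_
        rw [Matrix.single_apply, if_neg]
        rintro ⟨rfl, rfl⟩
        exact hij rfl
    rw [this, Matrix.mul_one]
  · rw [Matrix.trace_mul_comm, ← Matrix.mul_assoc, hU1]; simp
  · have : Matrix.diagonal (RCLike.ofReal ∘ h.eigenvalues : Fin d → ℂ)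
      = ∑ i, (h.eigenvalues i : ℂ) • Matrix.single i i (1 : ℂ) := by
      ext i j
      by_cases hij : i = j
      · subst hij
        simp [Matrix.sum_apply, Matrix.single_apply]
      · rw [Matrix.diagonal_apply_ne _ hij, Matrix.sum_apply]
        symm
        refine Finset.sum_eq_zero fun k _ => ?_
        rw [Matrix.smul_apply, Matrix.single_apply, if_neg, smul_zero]
        rintro ⟨rfl, rfl⟩
        exact hij rfl
    conv_lhs => rw [hsp, this]
    simp only [Finset.mul_sum, Finset.sum_mul, Matrix.mul_smul, Matrix.smul_mul]

lemma qeu_trnn {d : ℕ} (A B : Matrix (Fin d) (Fin d) ℂ) (hA : A.IsHermitian) (hA2 : A * A = A)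
    (hB : B.PosSemidef) : 0 ≤ ((B * A).trace).re := by
  have h := (hB.mul_mul_conjTranspose_same A).trace_nonneg
  rw [hA.eq, Matrix.trace_mul_comm, ← Matrix.mul_assoc, hA2, Matrix.trace_mul_comm] at h
  exact (Complex.le_def.1 h).1

lemma qeu_proj_psd {d : ℕ} (A : Matrix (Fin d) (Fin d) ℂ) (hA : A.IsHermitian) (hA2 : A * A = A) :
    A.PosSemidef := by
  have := Matrix.posSemidef_self_mul_conjTranspose A
  rwa [hA.eq, hA2] at this

lemma qeu_key {d : ℕ} (hd : 0 < d)
    (X Y : Fin d → Matrix (Fin d) (Fin d) ℂ)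
    (hXherm : ∀ i, (X i).IsHermitian) (hXproj : ∀ i, X i * X i = X i) (hXsum : ∑ i, X i = 1)
    (hYherm : ∀ j, (Y j).IsHermitian) (hYproj : ∀ j, Y j * Y j = Y j)
    (hYorth : ∀ j k, j ≠ k → Y j * Y k = 0) (hYsum : ∑ j, Y j = 1)
    (hYrank : ∀ j, (Y j).rank = 1)
    (ρ : Matrix (Fin d) (Fin d) ℂ) (hρ : ρ.PosSemidef) (hρtr : ρ.trace = 1)
    (a b : Fin d → ℝ) (ha : ∀ i, 0 < a i) (hb : ∀ i, 0 < b i) :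
    0 < ∑ j, (∑ i, a i * ((X i * Y j).trace).re) * b j ∧
    vonNeumannEntropy ρ + ∑ i, ((ρ * X i).trace).re * Real.log (a i)
      + ∑ j, ((ρ * Y j).trace).re * Real.log (b j)
      ≤ Real.log (∑ j, (∑ i, a i * ((X i * Y j).trace).re) * b j) := by
  have h := hρ.isHermitian
  obtain ⟨E, hEherm, hEproj, hEsum, hEtr, hE⟩ := qeu_spec ρ h
  set l := h.eigenvalues with hldef
  have hl : ∀ k, 0 ≤ l k := hρ.eigenvalues_nonneg
  set q : Fin d → ℝ := fun j => ((ρ * Y j).trace).re with hq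
  set a' : Fin d → ℝ := fun j => ∑ i, a i * ((X i * Y j).trace).re with ha'
  have hq0 : ∀ j, 0 ≤ q j := fun j => qeu_trnn _ _ (hYherm j) (hYproj j) hρ
  have hq1 : ∑ j, q j = 1 := by
    rw [hq, ← Complex.re_sum, ← Matrix.trace_sum, ← Finset.mul_sum, hYsum, Matrix.mul_one, hρtr]
    simp
  have hC0 : ∀ i j, 0 ≤ ((X i * Y j).trace).re := fun i j =>
    qeu_trnn _ _ (hYherm j) (hYproj j) (qeu_proj_psd _ (hXherm i) (hXproj i))
  have hCs : ∀ j, 0 < ∑ i, ((X i * Y j).trace).re := by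
    intro j
    rw [← Complex.re_sum, ← Matrix.trace_sum, ← Finset.sum_mul, hXsum, Matrix.one_mul]
    have hp := qeu_proj_psd _ (hYherm j) (hYproj j)
    have h1 := hp.trace_nonneg
    have h2 : (Y j).trace ≠ 0 := by
      intro h0
      rw [hp.trace_eq_zero_iff] at h0
      have := hYrank j
      rw [h0] at this
      simp at this
    exact (Complex.lt_def.1 (lt_of_le_of_ne h1 h2.symm)).1
  have ha'0 : ∀ j, 0 < a' j := by
    intro j
    obtain ⟨i, _, hi⟩ := Finset.exists_lt_of_sum_lt (s := Finset.univ)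
      (f := fun _ : Fin d => (0 : ℝ)) (g := fun i => ((X i * Y j).trace).re) (by simpa using hCs j)
    exact Finset.sum_pos' (fun i _ => mul_nonneg (ha i).le (hC0 i j))
      ⟨i, Finset.mem_univ _, mul_pos (ha i) hi⟩
  refine ⟨Finset.sum_pos (fun j _ => mul_pos (ha'0 j) (hb j)) ⟨⟨0, hd⟩, Finset.mem_univ _⟩, ?_⟩
  have hw : ∀ k, ∑ i, ((E k * X i).trace).re = 1 := by
    intro k
    rw [← Complex.re_sum, ← Matrix.trace_sum, ← Finset.mul_sum, hXsum, Matrix.mul_one, hEtr]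
    simp
  have hp : ∀ i, ((ρ * X i).trace).re = ∑ k, l k * ((E k * X i).trace).re := by
    intro i
    conv_lhs => rw [hE]
    simp only [Finset.sum_mul, Matrix.trace_sum, Matrix.smul_mul,
      Matrix.trace_smul, smul_eq_mul, Complex.re_sum, Complex.re_ofReal_mul]
  have hl1 : ∑ k, l k = 1 := by
    have h1 : ((∑ k, (l k : ℂ) • E k).trace).re = 1 := by rw [← hE, hρtr]; simp
    simpa [Matrix.trace_sum, hEtr] using h1
  have hA := qeu_real (ι := Fin d × Fin d) (κ := Fin d) (fun x => ((E x.1 * X x.2).trace).re)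
    (fun x => l x.1) (fun x => a x.2) q a' (fun x => hl _) (fun x => ha _) hq0 ha'0 (by
      intro s hs
      rw [Fintype.sum_prod_type]
      have := qeu_step E X Y hEherm hEproj hEsum hXherm hXproj hXsum hYherm hYproj hYorth l a
        (fun j => q j / (s * q j + a' j)) s hs hl ha
      rw [← hE] at this
      refine le_trans (le_of_eq ?_) this
      refine Finset.sum_congr rfl fun j _ => ?_
      change _ = 2 * (q j / (s * q j + a' j)) * q j - (q j / (s * q j + a' j)) ^ 2 * (s * q j + a' j)
      have h1 := hq0 j
      have h2 := ha'0 j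
      have : 0 < s * q j + a' j := by positivity
      field_simp
      ring) (by
      rw [Fintype.sum_prod_type]
      simp only [← Finset.sum_mul, hw, one_mul, hl1]) hq1
  have hB := qeu_gibbs q (fun j => a' j * b j) hq0 (fun j => mul_pos (ha'0 j) (hb j)) hq1
  have e1 : ∑ x : Fin d × Fin d,
      ((E x.1 * X x.2).trace).re * (l x.1 * (Real.log (l x.1) - Real.log (a x.2)))
      = - vonNeumannEntropy ρ - ∑ i, ((ρ * X i).trace).re * Real.log (a i) := by
    rw [vonNeumannEntropy, dif_pos h, neg_neg, Fintype.sum_prod_type]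
    simp only [hp, mul_sub, Finset.sum_sub_distrib, ← Finset.sum_mul, hw, one_mul]
    congr 1
    simp only [Finset.sum_mul]
    rw [Finset.sum_comm]
    refine Finset.sum_congr rfl fun i _ => Finset.sum_congr rfl fun k _ => ?_
    ring
  have e2 : ∑ j, q j * (Real.log (a' j * b j) - Real.log (q j))
      = ∑ j, q j * Real.log (b j) - ∑ j, q j * (Real.log (q j) - Real.log (a' j)) := by
    rw [← Finset.sum_sub_distrib]
    refine Finset.sum_congr rfl fun j _ => ?_
    rw [Real.log_mul (ha'0 j).ne' (hb j).ne']; ring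
  rw [e1] at hA
  rw [e2] at hB
  linarith

lemma qeu_norm {d : ℕ} (C : Matrix (Fin d) (Fin d) ℝ) (hd : 0 < d)
    (r s : ℝ) (hrs : r.HolderConjugate s) (a b : Fin d → ℝ) (ha : ∀ i, 0 < a i) (hb : ∀ i, 0 < b i)
    (hC : ∀ i j, 0 ≤ C i j) :
    ∑ j, (∑ i, a i * C i j) * b j ≤
      matPNorm r s (C.map Complex.ofReal) * ((∑ i, a i ^ r) ^ (1 / r) * (∑ i, b i ^ r) ^ (1 / r)) := by
  have hr := hrs.pos
  have hs := hrs.symm.pos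
  have hbdd : BddAbove {t : ℝ | ∃ φ : Fin d → ℂ, φ ≠ 0 ∧
      t = vecPNorm s ((C.map Complex.ofReal).mulVec φ) / vecPNorm r φ} := by
    refine ⟨((d : ℝ) * (∑ i, ∑ j, C i j) ^ s) ^ (1 / s), ?_⟩
    rintro t ⟨φ, hφ, rfl⟩
    set N := vecPNorm r φ with hN
    have hN0 : 0 ≤ N := by unfold N vecPNorm; positivity
    have hM : 0 ≤ ∑ i, ∑ j, C i j :=
      Finset.sum_nonneg fun i _ => Finset.sum_nonneg fun j _ => hC i j
    have hφN : ∀ j, ‖φ j‖ ≤ N := by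
      intro j
      have : ‖φ j‖ ^ r ≤ ∑ i, ‖φ i‖ ^ r :=
        Finset.single_le_sum (f := fun i => ‖φ i‖ ^ r) (fun i _ => by positivity) (Finset.mem_univ j)
      calc ‖φ j‖ = (‖φ j‖ ^ r) ^ (1 / r) := by
            rw [← Real.rpow_mul (norm_nonneg _), mul_one_div_cancel hr.ne', Real.rpow_one]
        _ ≤ _ := Real.rpow_le_rpow (by positivity) this (by positivity)
    refine div_le_of_le_mul₀ hN0 (by positivity) ?_
    have hv : ∀ i, ‖((C.map Complex.ofReal).mulVec φ) i‖ ≤ (∑ i, ∑ j, C i j) * N := by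
      intro i
      calc _ ≤ ∑ j, ‖(C i j : ℂ) * φ j‖ := norm_sum_le _ _
        _ ≤ ∑ j, C i j * N := by
            refine Finset.sum_le_sum fun j _ => ?_
            rw [norm_mul, Complex.norm_real, Real.norm_of_nonneg (hC i j)]
            exact mul_le_mul_of_nonneg_left (hφN j) (hC i j)
        _ = (∑ j, C i j) * N := by rw [Finset.sum_mul]
        _ ≤ _ := mul_le_mul_of_nonneg_right (Finset.single_le_sum (f := fun i => ∑ j, C i j)
            (fun i _ => Finset.sum_nonneg fun j _ => hC i j) (Finset.mem_univ i)) hN0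
    calc vecPNorm s ((C.map Complex.ofReal).mulVec φ)
        ≤ (∑ i : Fin d, ((∑ i, ∑ j, C i j) * N) ^ s) ^ (1 / s) := by
          unfold vecPNorm
          refine Real.rpow_le_rpow (by positivity) (Finset.sum_le_sum fun i _ => ?_) (by positivity)
          exact Real.rpow_le_rpow (norm_nonneg _) (hv i) hs.le
      _ = ((d : ℝ) * (∑ i, ∑ j, C i j) ^ s) ^ (1 / s) * N := by
          rw [Finset.sum_const, Finset.card_univ, Fintype.card_fin, nsmul_eq_mul,
            Real.mul_rpow hM hN0, ← mul_assoc, Real.mul_rpow (by positivity) (by positivity),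
            ← Real.rpow_mul hN0, mul_one_div_cancel hs.ne', Real.rpow_one]
  have hφ : (fun j => (b j : ℂ)) ≠ 0 := by
    intro h0
    have := congrFun h0 ⟨0, hd⟩
    simp at this
    exact (hb _).ne' this
  have hle := le_csSup hbdd ⟨_, hφ, rfl⟩
  have hvb : vecPNorm r (fun j => (b j : ℂ)) = (∑ i, b i ^ r) ^ (1 / r) := by
    unfold vecPNorm
    simp only [Complex.norm_real, Real.norm_of_nonneg (hb _).le]
  have hCb : ∀ i, 0 ≤ ∑ j, C i j * b j := fun i =>
    Finset.sum_nonneg fun j _ => mul_nonneg (hC i j) (hb j).le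
  have hvC : vecPNorm s ((C.map Complex.ofReal).mulVec (fun j => (b j : ℂ)))
      = (∑ i, (∑ j, C i j * b j) ^ s) ^ (1 / s) := by
    unfold vecPNorm
    congr 1
    refine Finset.sum_congr rfl fun i _ => ?_
    have : (C.map Complex.ofReal).mulVec (fun j => (b j : ℂ)) i = ((∑ j, C i j * b j : ℝ) : ℂ) := by
      simp [Matrix.mulVec, dotProduct]
    rw [this, Complex.norm_real, Real.norm_of_nonneg (hCb i)]
  rw [hvb, hvC] at hle
  change _ ≤ matPNorm r s (C.map Complex.ofReal) at hle
  have hbpos : 0 < (∑ i, b i ^ r) ^ (1 / r) := by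
    have : 0 < ∑ i, b i ^ r :=
      Finset.sum_pos (fun i _ => Real.rpow_pos_of_pos (hb i) r) ⟨⟨0, hd⟩, Finset.mem_univ _⟩
    positivity
  rw [div_le_iff₀ hbpos] at hle
  have hH := Real.inner_le_Lp_mul_Lq_of_nonneg Finset.univ hrs (f := a)
    (g := fun i => ∑ j, C i j * b j) (fun i _ => (ha i).le) (fun i _ => hCb i)
  have e : ∑ j, (∑ i, a i * C i j) * b j = ∑ i, a i * ∑ j, C i j * b j := by
    simp only [Finset.sum_mul, Finset.mul_sum]
    rw [Finset.sum_comm]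
    simp only [mul_assoc]
  rw [e]
  refine hH.trans ?_
  have ha0 : 0 ≤ (∑ i, a i ^ r) ^ (1 / r) := by
    have : 0 ≤ ∑ i, a i ^ r := Finset.sum_nonneg fun i _ => Real.rpow_nonneg (ha i).le r
    positivity
  calc _ ≤ _ := mul_le_mul_of_nonneg_left hle ha0
    _ = _ := by ring

/-- **Qudit entropic uncertainty relation in the extended MUB regime.** For rank-one
projective measurements `X, Y` on `ℂ^d` with overlap matrix `C⁽²⁾`, and `σ ∈ (0,1)` such
that `‖C⁽²⁾‖_{(1+σ)→((1+σ)/σ)} ≤ d^(-(1-σ)/(1+σ))` (the conjectured MUB-regime value with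
`σ = σ₂` and `μ = λ = 1/(1+σ)`), every density matrix `ρ` satisfies
`H(X) + H(Y) ≥ (1+σ) S(ρ) + (1-σ) log d`. -/
theorem qudit_entropic_uncertainty {d : ℕ}
    (X Y : Fin d → Matrix (Fin d) (Fin d) ℂ)
    (hXherm : ∀ i, (X i).IsHermitian) (hXproj : ∀ i, X i * X i = X i)
    (hXorth : ∀ i j, i ≠ j → X i * X j = 0) (hXsum : ∑ i, X i = 1)
    (hXrank : ∀ i, (X i).rank = 1)
    (hYherm : ∀ j, (Y j).IsHermitian) (hYproj : ∀ j, Y j * Y j = Y j)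
    (hYorth : ∀ j k, j ≠ k → Y j * Y k = 0) (hYsum : ∑ j, Y j = 1)
    (hYrank : ∀ j, (Y j).rank = 1)
    (C2 : Matrix (Fin d) (Fin d) ℝ)
    (hC2 : ∀ i j, (C2 i j : ℂ) = (X i * Y j).trace)
    (σ : ℝ) (hσ0 : 0 < σ) (hσ1 : σ < 1)
    (hnorm : matPNorm (1 + σ) ((1 + σ) / σ) (C2.map Complex.ofReal)
        ≤ (d : ℝ) ^ (-(1 - σ) / (1 + σ)))
    (ρ : Matrix (Fin d) (Fin d) ℂ) (hρ : ρ.PosSemidef) (hρtr : ρ.trace = 1) :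
    shannonEntropy (fun i => ((ρ * X i).trace).re)
      + shannonEntropy (fun j => ((ρ * Y j).trace).re)
    ≥ (1 + σ) * vonNeumannEntropy ρ + (1 - σ) * Real.log d := by
  have hd : 0 < d := by
    rcases Nat.eq_zero_or_pos d with rfl | h
    · simp [Matrix.trace] at hρtr
    · exact h
  have hdR : (0 : ℝ) < d := by exact_mod_cast hd
  have hC : ∀ i j, C2 i j = ((X i * Y j).trace).re := fun i j => by rw [← hC2]; simp
  have hC0 : ∀ i j, 0 ≤ C2 i j := fun i j => by
    rw [hC]
    exact qeu_trnn _ _ (hYherm j) (hYproj j) (qeu_proj_psd _ (hXherm i) (hXproj i))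
  set p : Fin d → ℝ := fun i => ((ρ * X i).trace).re with hp
  set q : Fin d → ℝ := fun j => ((ρ * Y j).trace).re with hq
  have hp0 : ∀ j, 0 ≤ p j := fun j => qeu_trnn _ _ (hXherm j) (hXproj j) hρ
  have hp1 : ∑ j, p j = 1 := by
    rw [hp, ← Complex.re_sum, ← Matrix.trace_sum, ← Finset.mul_sum, hXsum, Matrix.mul_one, hρtr]
    simp
  have hq0 : ∀ j, 0 ≤ q j := fun j => qeu_trnn _ _ (hYherm j) (hYproj j) hρ
  have hq1 : ∑ j, q j = 1 := by
    rw [hq, ← Complex.re_sum, ← Matrix.trace_sum, ← Finset.mul_sum, hYsum, Matrix.mul_one, hρtr]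
    simp
  have hs : (0 : ℝ) < 1 + σ := by linarith
  have hrs : (1 + σ).HolderConjugate ((1 + σ) / σ) := by
    rw [Real.holderConjugate_iff]
    refine ⟨by linarith, ?_⟩
    field_simp
  have main : ∀ ε : ℝ, 0 < ε → (1 + σ) * vonNeumannEntropy ρ + (1 - σ) * Real.log d ≤
      shannonEntropy p + shannonEntropy q + 2 * Real.log (1 + d * ε) := by
    intro ε hε
    have pos : ∀ x : ℝ, 0 ≤ x → 0 < (x + ε) ^ (1 / (1 + σ)) := fun x hx =>
      Real.rpow_pos_of_pos (by positivity) _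
    obtain ⟨hT0, hk⟩ := qeu_key hd X Y hXherm hXproj hXsum hYherm hYproj hYorth hYsum hYrank ρ hρ hρtr
      (fun i => (p i + ε) ^ (1 / (1 + σ))) (fun i => (q i + ε) ^ (1 / (1 + σ)))
      (fun i => pos _ (hp0 i)) (fun i => pos _ (hq0 i))
    have hn := qeu_norm C2 hd _ _ hrs
      (fun i => (p i + ε) ^ (1 / (1 + σ))) (fun i => (q i + ε) ^ (1 / (1 + σ)))
      (fun i => pos _ (hp0 i)) (fun i => pos _ (hq0 i)) hC0
    have hsum : ∀ x : Fin d → ℝ, (∀ i, 0 ≤ x i) → ∑ i, x i = 1 →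
        ∑ i, ((x i + ε) ^ (1 / (1 + σ))) ^ (1 + σ) = 1 + d * ε := by
      intro x hx hx1
      have : ∀ i, ((x i + ε) ^ (1 / (1 + σ))) ^ (1 + σ) = x i + ε := by
        intro i
        have := hx i
        rw [← Real.rpow_mul (by positivity), one_div_mul_cancel hs.ne', Real.rpow_one]
      simp only [this, Finset.sum_add_distrib, hx1]
      simp
    rw [hsum p hp0 hp1, hsum q hq0 hq1] at hn
    have hD : 0 < 1 + d * ε := by positivity
    have hn2 := hn.trans (mul_le_mul_of_nonneg_right hnorm (by positivity))
    simp only [hC] at hn2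
    have hlogT := Real.log_le_log hT0 hn2
    rw [Real.log_mul (by positivity) (by positivity), Real.log_mul (by positivity) (by positivity),
      Real.log_rpow hdR, Real.log_rpow hD] at hlogT
    have hent : ∀ x : Fin d → ℝ, (∀ i, 0 ≤ x i) →
        -shannonEntropy x ≤ (1 + σ) * ∑ i, x i * Real.log ((x i + ε) ^ (1 / (1 + σ))) := by
      intro x hx
      rw [shannonEntropy, neg_neg, Finset.mul_sum]
      refine Finset.sum_le_sum fun i _ => ?_
      have h0 := hx i
      rw [Real.log_rpow (by positivity)]
      have : (1 + σ) * (x i * (1 / (1 + σ) * Real.log (x i + ε))) = x i * Real.log (x i + ε) := by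
        field_simp
      rw [this]
      rcases h0.eq_or_lt with h | h
      · simp [← h]
      · exact mul_le_mul_of_nonneg_left (Real.log_le_log h (by linarith)) h0
    have h1 := hent p hp0
    have h2 := hent q hq0
    have h3 := mul_le_mul_of_nonneg_left (hk.trans hlogT) hs.le
    have h4 : (1 + σ) * (-(1 - σ) / (1 + σ) * Real.log d
       + (1 / (1 + σ) * Real.log (1 + d * ε) + 1 / (1 + σ) * Real.log (1 + d * ε)))
       = - (1 - σ) * Real.log d + 2 * Real.log (1 + d * ε) := by
      field_simp; ring
    rw [h4, mul_add, mul_add] at h3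
    simp only [hp, hq] at h1 h2 h3 ⊢
    linarith
  have hlim : Tendsto (fun ε : ℝ => shannonEntropy p + shannonEntropy q + 2 * Real.log (1 + d * ε))
      (𝓝[>] 0) (𝓝 (shannonEntropy p + shannonEntropy q)) := by
    have : ContinuousAt
        (fun ε : ℝ => shannonEntropy p + shannonEntropy q + 2 * Real.log (1 + d * ε)) 0 := by
      refine ContinuousAt.add continuousAt_const
        (continuousAt_const.mul (ContinuousAt.log (by fun_prop) (by simp)))
    have h := this.tendsto.mono_left (nhdsWithin_le_nhds (s := Set.Ioi 0))
    simpa using h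
  refine ge_of_tendsto hlim ?_
  filter_upwards [self_mem_nhdsWithin] with ε hε using main ε hε
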